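/- arXiv:2505.14551 — 4 statements merged into one kernel-verified Lean document; each statement's English description precedes it below -/
import Mathlib

section
/- Let n, m ≥ 1, α ∈ (0,1), and let T, T′ be as follows: T is an n×(n+m) real matrix with nonnegative rows summing to 1 (indices 1,…,n are users, indices n+1,…,n+m are servers); T′ is the (n+m)×(n+m) matrix with T′[i,j] = (1−α)T[i,j] + α/n for user rows i and user columns j, T′[i,ĵ] = (1−α)T[i,ĵ] for user rows i and server columns ĵ, and T′[ĵ,j] = 1/n for server rows ĵ and user columns j, 0 for server columns. Suppose there exist constants c_i ≥ 0 (i = 1,…,n) and R_j > 0 (j = 1,…,m) such that T[i, n+j] = c_i · R_j for every user i and server j. Then any vector π ∈ ℝ^{n+m} with π · T′ = π is ratio-preserving on the servers: π_{n+j} · R_k = π_{n+k} · R_j for all j, k ∈ {1,…,m}. -/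
/-- Designated PageRank on a perfectly informed Designated Reputation graph: if every
user's endorsement probabilities toward the servers are proportional to the servers'
trustworthiness scores `R` (with a user-dependent constant `c i`), then any stationary
vector of the modified chain `T'` is ratio-preserving on the servers. -/
theorem stmt_2 (n m : ℕ) (hn : 1 ≤ n) (hm : 1 ≤ m) (α : ℝ) (hα : α ∈ Set.Ioo (0 : ℝ) 1)
    (T : Fin n → (Fin n ⊕ Fin m) → ℝ)
    (hT0 : ∀ i j, 0 ≤ T i j) (hT1 : ∀ i, ∑ j, T i j = 1)
    (T' : (Fin n ⊕ Fin m) → (Fin n ⊕ Fin m) → ℝ)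
    (hT'uu : ∀ (i : Fin n) (j : Fin n),
      T' (Sum.inl i) (Sum.inl j) = (1 - α) * T i (Sum.inl j) + α / n)
    (hT'us : ∀ (i : Fin n) (j : Fin m),
      T' (Sum.inl i) (Sum.inr j) = (1 - α) * T i (Sum.inr j))
    (hT'su : ∀ (i : Fin m) (j : Fin n), T' (Sum.inr i) (Sum.inl j) = 1 / n)
    (hT'ss : ∀ (i : Fin m) (j : Fin m), T' (Sum.inr i) (Sum.inr j) = 0)
    (c : Fin n → ℝ) (hc : ∀ i, 0 ≤ c i)
    (R : Fin m → ℝ) (hR : ∀ j, 0 < R j)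
    (hprop : ∀ (i : Fin n) (j : Fin m), T i (Sum.inr j) = c i * R j)
    (π : (Fin n ⊕ Fin m) → ℝ)
    (hπ : ∀ j, ∑ i, π i * T' i j = π j) :
    ∀ j k : Fin m, π (Sum.inr j) * R k = π (Sum.inr k) * R j := by
  have server_mass : ∀ j : Fin m,
      π (Sum.inr j) = (∑ i : Fin n, π (Sum.inl i) * ((1 - α) * c i)) * R j := by
    intro j
    rw [← hπ (Sum.inr j), Fintype.sum_sum_type, Finset.sum_mul]
    simp only [hT'us, hT'ss, hprop, mul_zero, Finset.sum_const_zero, add_zero]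
    exact Finset.sum_congr rfl fun i _ => by ring
  intro j k
  rw [server_mass j, server_mass k]
  ring
end

section
/- Let m ≥ 1, n ≥ 2, and let R ∈ ℝ^m with R_j > 0 for all j. Write N(R)_j = R_j / ∑_{k=1}^m R_k for the L1-normalization of R. Then for every t ∈ ℝ^m with t_j ≥ 0 for all j and ∑_{j=1}^m t_j = n − 1, one has ∑_{j=1}^m (N(R)_j · R_j)/(t_j + N(R)_j) ≥ (∑_{j=1}^m R_j)/n, with equality if and only if t_j = (n−1)·N(R)_j for every j. -/
/-- The excess of `∑ S a² / x` over its Cauchy-Schwarz lower bound, as a sum of squares. -/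
theorem sum_mul_sq_div_eq_add_sum_sq {ι : Type*} [Fintype ι] (S c : ℝ) (hc : c ≠ 0) (a x : ι → ℝ)
    (hx : ∀ j, x j ≠ 0) (ha : ∑ j, a j = 1) (hxc : ∑ j, x j = c) :
    ∑ j, a j * (S * a j) / x j = S / c + ∑ j, S * (a j - x j / c) ^ 2 / x j := by
  have hterm (j : ι) : a j * (S * a j) / x j =
      2 * S / c * a j - S / c ^ 2 * x j + S * (a j - x j / c) ^ 2 / x j := by
    have := hx j
    field_simp
    ring
  rw [Finset.sum_congr rfl fun j _ => hterm j, Finset.sum_add_distrib, Finset.sum_sub_distrib,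
    ← Finset.mul_sum, ← Finset.mul_sum, ha, hxc]
  field_simp
  ring


/-- Non-exploitability of playing the L1-normalized trustworthiness vector `N(R)`:
against any opponents' aggregate `t` (entrywise nonnegative, summing to `n - 1`), the
guaranteed payoff is at least the equal share `(∑ R) / n`, with equality iff
`t j = (n - 1) * N(R) j` for every `j`. -/
theorem stmt_3 (m n : ℕ) (hm : 1 ≤ m) (hn : 2 ≤ n)
    (R : Fin m → ℝ) (hR : ∀ j, 0 < R j)
    (N : Fin m → ℝ) (hN : ∀ j, N j = R j / ∑ k, R k)
    (t : Fin m → ℝ) (ht0 : ∀ j, 0 ≤ t j) (ht1 : ∑ j, t j = (n : ℝ) - 1) :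
    ((∑ j, R j) / n ≤ ∑ j, N j * R j / (t j + N j)) ∧
    ((∑ j, N j * R j / (t j + N j)) = (∑ j, R j) / n ↔
      ∀ j, t j = ((n : ℝ) - 1) * N j) := by
  have : NeZero m := ⟨by omega⟩
  have hS : 0 < ∑ k, R k := Finset.sum_pos (fun j _ => hR j) Finset.univ_nonempty
  have hn0 : (n : ℝ) ≠ 0 := by positivity
  have hNpos (j : Fin m) : 0 < N j := by rw [hN]; exact div_pos (hR j) hS
  have hRN (j : Fin m) : R j = (∑ k, R k) * N j := by rw [hN]; field_simp
  have hNsum : ∑ j, N j = 1 := by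
    simp_rw [hN]
    rw [← Finset.sum_div, div_self hS.ne']
  have hx (j : Fin m) : 0 < t j + N j := add_pos_of_nonneg_of_pos (ht0 j) (hNpos j)
  have key : ∑ j, N j * R j / (t j + N j) = (∑ k, R k) / n +
      ∑ j, (∑ k, R k) * (N j - (t j + N j) / n) ^ 2 / (t j + N j) := by
    rw [← sum_mul_sq_div_eq_add_sum_sq _ _ hn0 N (fun j => t j + N j) (fun j => (hx j).ne') hNsum
      (by rw [Finset.sum_add_distrib, ht1, hNsum]; ring)]
    exact Finset.sum_congr rfl fun j _ => by rw [← hRN j]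
  have hnonneg (j : Fin m) :
      0 ≤ (∑ k, R k) * (N j - (t j + N j) / n) ^ 2 / (t j + N j) :=
    div_nonneg (mul_nonneg hS.le (sq_nonneg _)) (hx j).le
  rw [key]
  refine ⟨le_add_of_nonneg_right (Finset.sum_nonneg fun j _ => hnonneg j), ?_⟩
  rw [add_eq_left, Finset.sum_eq_zero_iff_of_nonneg fun j _ => hnonneg j]
  simp only [Finset.mem_univ, true_imp_iff]
  refine forall_congr' fun j => ?_
  rw [div_eq_zero_iff, or_iff_left (hx j).ne', mul_eq_zero, or_iff_right hS.ne', sq_eq_zero_iff,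
    sub_eq_zero, eq_div_iff hn0]
  constructor <;> intro h <;> linarith
end

section
/- In the perfect-information trustworthy reputation game G_perfect with n ≥ 2 players, m ≥ 2 servers, and trustworthiness scores R ∈ ℝ^m with R_j > 0 for all j, a strategy profile s = (s^(1),…,s^(n)) is a Nash equilibrium if and only if s^(i)_j = N(R)_j for every player i and every server j, where N(R)_j = R_j/∑_{k=1}^m R_k. In particular, G_perfect has a unique Nash equilibrium, namely the symmetric profile in which every player plays the L1-normalization N(R). -/
lemma sum_update_apply {ι κ : Type*} [Fintype ι] [DecidableEq ι] (s : ι → κ → ℝ) (i : ι)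
    (t : κ → ℝ) (j : κ) :
    ∑ k, Function.update s i t k j = (∑ k, s k j) - s i j + t j := by
  have h₁ := Finset.add_sum_erase Finset.univ (fun k => s k j) (Finset.mem_univ i)
  have h₂ := Finset.add_sum_erase Finset.univ (fun k => Function.update s i t k j)
    (Finset.mem_univ i)
  have h₃ : ∑ k ∈ Finset.univ.erase i, Function.update s i t k j
      = ∑ k ∈ Finset.univ.erase i, s k j :=
    Finset.sum_congr rfl fun k hk => by
      rw [Function.update_of_ne (Finset.ne_of_mem_erase hk)]
  simp only [Function.update_self] at h₁ h₂
  linarith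

lemma le_of_forall_small_le_add_mul {X Y K δ : ℝ} (hδ : 0 < δ)
    (h : ∀ ε, 0 < ε → ε < δ → X ≤ Y + K * ε) : X ≤ Y := by
  by_contra! hXY
  have hK : 0 < |K| + 1 := by positivity
  have hq : 0 < (X - Y) / (|K| + 1) := div_pos (by linarith) hK
  obtain ⟨ε, hε, hlt⟩ := exists_between (lt_min hδ hq)
  have h₁ := h ε hε (hlt.trans_le (min_le_left _ _))
  have h₂ := (lt_div_iff₀ hK).1 (hlt.trans_le (min_le_right _ _))
  nlinarith [le_abs_self K]

/-- A best response cannot be improved by moving mass `ε` from server `l` to server `j`. -/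
lemma transfer_le_of_best_response {κ : Type*} [Fintype κ] [DecidableEq κ] {R x T : κ → ℝ}
    (hx0 : ∀ j, 0 ≤ x j) (hx1 : ∑ j, x j = 1)
    (hbest : ∀ y : κ → ℝ, (∀ j, 0 ≤ y j) → ∑ j, y j = 1 →
      ∑ j, R j * y j / (T j - x j + y j) ≤ ∑ j, R j * x j / T j)
    {j l : κ} (hjl : j ≠ l) {ε : ℝ} (hε : 0 < ε) (hεl : ε ≤ x l) :
    R j * (x j + ε) / (T j + ε) + R l * (x l - ε) / (T l - ε)
      ≤ R j * x j / T j + R l * x l / T l := by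
  set y : κ → ℝ := Function.update (Function.update x l (x l - ε)) j (x j + ε) with hy
  have hyj : y j = x j + ε := by simp [hy]
  have hyl : y l = x l - ε := by simp [hy, hjl.symm]
  have hyk : ∀ k, k ≠ j ∧ k ≠ l → y k = x k := fun k hk => by simp [hy, hk.1, hk.2]
  have hy0 : ∀ k, 0 ≤ y k := by
    intro k
    by_cases h₁ : k = j
    · subst h₁; rw [hyj]; linarith [hx0 k]
    by_cases h₂ : k = l
    · subst h₂; rw [hyl]; linarith
    rw [hyk k ⟨h₁, h₂⟩]; exact hx0 k
  have hy1 : ∑ k, y k = 1 := by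
    have h := Fintype.sum_eq_add (f := fun k => y k - x k) j l hjl
      fun k hk => by simp [hyk k hk]
    rw [Finset.sum_sub_distrib] at h
    linarith
  have h := Fintype.sum_eq_add
    (f := fun k => R k * y k / (T k - x k + y k) - R k * x k / T k) j l hjl
    fun k hk => by simp [hyk k hk]
  rw [Finset.sum_sub_distrib, hyj, hyl] at h
  have hT₁ : T j - x j + (x j + ε) = T j + ε := by ring
  have hT₂ : T l - x l + (x l - ε) = T l - ε := by ring
  rw [hT₁, hT₂] at h
  linarith [hbest y hy0 hy1]

lemma total_pos_of_best_response {κ : Type*} [Fintype κ] [DecidableEq κ] {R x T : κ → ℝ}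
    (hR : ∀ j, 0 < R j) (hx0 : ∀ j, 0 ≤ x j) (hx1 : ∑ j, x j = 1) (hxT : ∀ j, x j ≤ T j)
    (hbest : ∀ y : κ → ℝ, (∀ j, 0 ≤ y j) → ∑ j, y j = 1 →
      ∑ j, R j * y j / (T j - x j + y j) ≤ ∑ j, R j * x j / T j) (j : κ) :
    0 < T j := by
  by_contra! hTj
  have hT : T j = 0 := le_antisymm hTj ((hx0 j).trans (hxT j))
  have hxj : x j = 0 := le_antisymm (hT ▸ hxT j) (hx0 j)
  obtain ⟨l, -, hl⟩ := Finset.exists_lt_of_sum_lt (s := Finset.univ) (f := fun _ : κ => (0 : ℝ))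
    (g := x) (by simp [hx1])
  have hjl : j ≠ l := by rintro rfl; exact hl.ne' hxj
  have hTl : 0 < T l := hl.trans_le (hxT l)
  have key : R j * T l ^ 2 ≤ 0 := by
    refine le_of_forall_small_le_add_mul (K := R l * (T l - x l) + R j * T l) hl
      fun ε hε hεl => ?_
    have h := transfer_le_of_best_response hx0 hx1 hbest hjl hε hεl.le
    have hd : 0 < T l - ε := by linarith [hxT l]
    rw [hT, hxj, zero_add, mul_div_assoc, div_self hε.ne', mul_zero, zero_div, zero_add,
      mul_one] at h
    have h' : R j ≤ R l * x l / T l - R l * (x l - ε) / (T l - ε) := by linarith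
    rw [div_sub_div _ _ hTl.ne' hd.ne', le_div_iff₀ (mul_pos hTl hd)] at h'
    linarith
  have := mul_pos (hR j) (pow_pos hTl 2)
  linarith

/-- First-order condition: marginal utility is maximal on the support of a best response. -/
lemma marginal_le_of_best_response {κ : Type*} [Fintype κ] [DecidableEq κ] {R x T : κ → ℝ}
    (hx0 : ∀ j, 0 ≤ x j) (hx1 : ∑ j, x j = 1) (hxT : ∀ j, x j ≤ T j) (hT : ∀ j, 0 < T j)
    (hbest : ∀ y : κ → ℝ, (∀ j, 0 ≤ y j) → ∑ j, y j = 1 →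
      ∑ j, R j * y j / (T j - x j + y j) ≤ ∑ j, R j * x j / T j)
    (j : κ) {l : κ} (hl : 0 < x l) :
    R j / T j ^ 2 * (T j - x j) ≤ R l / T l ^ 2 * (T l - x l) := by
  rcases eq_or_ne j l with rfl | hjl
  · rfl
  have hTj := hT j
  have hTl := hT l
  rw [div_mul_eq_mul_div, div_mul_eq_mul_div, div_le_div_iff₀ (by positivity) (by positivity)]
  refine le_of_forall_small_le_add_mul
    (K := R l * (T l - x l) * T j + R j * (T j - x j) * T l) hl fun ε hε hεl => ?_
  have h := transfer_le_of_best_response hx0 hx1 hbest hjl hε hεl.le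
  have hd : 0 < T l - ε := by linarith [hxT l]
  have hd' : 0 < T j + ε := by linarith
  have e₁ : R j * (x j + ε) / (T j + ε) - R j * x j / T j
      = ε * (R j * (T j - x j) / (T j * (T j + ε))) := by
    field_simp; ring
  have e₂ : R l * x l / T l - R l * (x l - ε) / (T l - ε)
      = ε * (R l * (T l - x l) / (T l * (T l - ε))) := by
    field_simp; ring
  have h' := le_of_mul_le_mul_left (e₁ ▸ e₂ ▸ (by linarith) :
    ε * (R j * (T j - x j) / (T j * (T j + ε))) ≤ ε * (R l * (T l - x l) / (T l * (T l - ε)))) hε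
  rw [div_le_div_iff₀ (by positivity) (by positivity)] at h'
  linarith

lemma mul_div_add_mul_le_tangent {p x c : ℝ} (hp : 0 < p) (hx : 0 ≤ x) (hc : 0 < c) :
    p * x / (x + c * p) ≤ p / (1 + c) + c / (1 + c) ^ 2 * (x - p) := by
  have hd : 0 < x + c * p := by positivity
  have e : p / (1 + c) + c / (1 + c) ^ 2 * (x - p) - p * x / (x + c * p)
      = c * (x - p) ^ 2 / ((1 + c) ^ 2 * (x + c * p)) := by
    field_simp; ring
  have : 0 ≤ c * (x - p) ^ 2 / ((1 + c) ^ 2 * (x + c * p)) := by positivity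
  linarith


/-- Lemma 5.1: in the perfect-information trustworthy reputation game, a strategy
profile `s` is a Nash equilibrium iff every player plays the L1-normalization `N(R)`
of the trustworthiness vector; in particular the Nash equilibrium is unique.
Player `i`'s utility is `∑ j, R j * s i j / (∑ k, s k j)` (division by `0` yields `0`). -/
theorem stmt_6 (n m : ℕ) (hn : 2 ≤ n) (hm : 2 ≤ m)
    (R : Fin m → ℝ) (hR : ∀ j, 0 < R j)
    (s : Fin n → Fin m → ℝ)
    (hs0 : ∀ i j, 0 ≤ s i j) (hs1 : ∀ i, ∑ j, s i j = 1) :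
    (∀ (i : Fin n) (s' : Fin m → ℝ), (∀ j, 0 ≤ s' j) → (∑ j, s' j) = 1 →
        ∑ j, R j * s' j / (∑ k, Function.update s i s' k j) ≤
          ∑ j, R j * s i j / (∑ k, s k j)) ↔
      (∀ i j, s i j = R j / ∑ k, R k) := by
  have hSpos : 0 < ∑ k, R k :=
    Finset.sum_pos (fun k _ => hR k) ⟨⟨0, by omega⟩, Finset.mem_univ _⟩
  have hn' : (2 : ℝ) ≤ n := by exact_mod_cast hn
  simp only [sum_update_apply]
  constructor
  · intro hN
    set T : Fin m → ℝ := fun j => ∑ k, s k j with hTdef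
    have hxT : ∀ i j, s i j ≤ T j := fun i j =>
      Finset.single_le_sum (f := fun k => s k j) (fun k _ => hs0 k j) (Finset.mem_univ i)
    have hT : ∀ j, 0 < T j :=
      total_pos_of_best_response hR (hs0 ⟨0, by omega⟩) (hs1 _) (hxT _) (hN _)
    have hmarg : ∀ i j l, 0 < s i l →
        R j / T j ^ 2 * (T j - s i j) ≤ R l / T l ^ 2 * (T l - s i l) := fun i j l hl =>
      marginal_le_of_best_response (hs0 i) (hs1 i) (hxT i) hT (hN i) j hl
    have hw : ∀ j, 0 < R j / T j ^ 2 := fun j => div_pos (hR j) (pow_pos (hT j) 2)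
    have hle : ∀ i k j, s i j ≤ s k j := by
      intro i k l
      by_contra! hl
      obtain ⟨j, hj⟩ : ∃ j, s i j < s k j := by
        by_contra! hall
        have := Finset.sum_lt_sum (s := Finset.univ) (fun j _ => hall j)
          ⟨l, Finset.mem_univ l, hl⟩
        rw [hs1, hs1] at this
        exact this.false
      have h₁ := hmarg i j l ((hs0 k l).trans_lt hl)
      have h₂ := hmarg k l j ((hs0 i j).trans_lt hj)
      have h₃ := mul_lt_mul_of_pos_left hl (hw l)
      have h₄ := mul_lt_mul_of_pos_left hj (hw j)
      linarith
    have hTs : ∀ i j, T j = n * s i j := by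
      intro i j
      have : T j = ∑ _k : Fin n, s i j :=
        Finset.sum_congr rfl fun k _ => le_antisymm (hle k i j) (hle i k j)
      simpa using this
    have hpos : ∀ i j, 0 < s i j := fun i j =>
      pos_of_mul_pos_right (hTs i j ▸ hT j) (by linarith)
    have hcross : ∀ i j l, R j * s i l ≤ R l * s i j := by
      intro i j l
      have h := hmarg i j l (hpos i l)
      have hj := hpos i j
      have hl := hpos i l
      have e : ∀ k, R k / T k ^ 2 * (T k - s i k) = (n - 1) / n ^ 2 * (R k / s i k) := by
        intro k
        have := hpos i k
        rw [hTs i k]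
        field_simp
      rw [e, e] at h
      have hc : (0 : ℝ) < (n - 1) / n ^ 2 := div_pos (by linarith) (by positivity)
      exact (div_le_div_iff₀ hj hl).1 (le_of_mul_le_mul_left h hc)
    intro i j
    rw [eq_div_iff hSpos.ne', Finset.mul_sum]
    calc ∑ l, s i j * R l = ∑ l, R j * s i l := Finset.sum_congr rfl fun l _ => by
          rw [mul_comm]; exact le_antisymm (hcross i l j) (hcross i j l)
      _ = R j := by rw [← Finset.mul_sum, hs1, mul_one]
  · intro hs i y hy0 hy1
    set S := ∑ k, R k with hS
    have hp : ∀ j, 0 < R j / S := fun j => div_pos (hR j) hSpos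
    have hp1 : ∑ j, R j / S = 1 := by rw [← Finset.sum_div, div_self hSpos.ne']
    have hT : ∀ j, ∑ k, s k j = n * (R j / S) := fun j => by simp [hs]
    have hterm : ∀ j, R j * y j / ((∑ k, s k j) - s i j + y j)
        ≤ R j * s i j / (∑ k, s k j) + S * ((n - 1) / n ^ 2) * (y j - R j / S) := by
      intro j
      have h := mul_le_mul_of_nonneg_left
        (mul_div_add_mul_le_tangent (hp j) (hy0 j) (c := n - 1) (by linarith)) hSpos.le
      have e₁ : S * (R j / S * y j / (y j + (n - 1) * (R j / S)))
          = R j * y j / ((∑ k, s k j) - s i j + y j) := by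
        rw [hT, hs, ← mul_div_assoc, ← mul_assoc, mul_div_cancel₀ _ hSpos.ne']
        congr 1
        ring
      have e₂ : R j * s i j / (∑ k, s k j) = S * (R j / S / (1 + (n - 1))) := by
        have := hR j
        rw [hT, hs, add_sub_cancel]
        field_simp
      rw [e₁, mul_add, ← e₂, add_sub_cancel, ← mul_assoc] at h
      exact h
    refine (Finset.sum_le_sum fun j _ => hterm j).trans_eq ?_
    rw [Finset.sum_add_distrib, ← Finset.mul_sum, Finset.sum_sub_distrib, hy1, hp1]
    ring
end

section
/- Let m ≥ 1, n ≥ 2, and let R, R′ ∈ ℝ^m with R_j > 0 and R′_j > 0 for all j. Set b_j = R′_j/∑_{k=1}^m R′_k and define x*_j = n·√(R_j·R′_j)/∑_{k=1}^m √(R_k·R′_k) − (n−1)·b_j for j = 1,…,m. Then ∑_{j=1}^m x*_j = 1, and if x*_j ≥ 0 for every j, then x* maximizes the function f(x) = ∑_{j=1}^m x_j·R_j/((n−1)·b_j + x_j) over the simplex {x ∈ ℝ^m : x_j ≥ 0 for all j, ∑_{j=1}^m x_j = 1}; that is, f(x) ≤ f(x*) for every x in this simplex. -/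
/-- The concave function `x ↦ x * r / (c + x)` lies below each of its tangent lines. -/
theorem mul_div_add_le_tangent {r c x y : ℝ} (hr : 0 ≤ r) (hc : 0 ≤ c)
    (hx : 0 < c + x) (hy : 0 < c + y) :
    x * r / (c + x) ≤ y * r / (c + y) + r * c / (c + y) ^ 2 * (x - y) := by
  have key : y * r / (c + y) + r * c / (c + y) ^ 2 * (x - y) - x * r / (c + x) =
      r * c * (x - y) ^ 2 / ((c + y) ^ 2 * (c + x)) := by
    field_simp
    ring
  have : 0 ≤ r * c * (x - y) ^ 2 / ((c + y) ^ 2 * (c + x)) := by positivity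
  linarith

/-- Best-response computation of Lemma 6.1: when the other `n - 1` players all play the
L1-normalization `b = N(R')` of the common noisy belief `R'`, the point `x*` given by the
square-root formula sums to `1`, and whenever it is entrywise nonnegative it maximizes
the expected utility `f(x) = ∑ j, x j * R j / ((n-1) * b j + x j)` over the simplex. -/
theorem stmt_12 (m n : ℕ) (hm : 1 ≤ m) (hn : 2 ≤ n)
    (R R' : Fin m → ℝ) (hR : ∀ j, 0 < R j) (hR' : ∀ j, 0 < R' j)
    (b : Fin m → ℝ) (hb : ∀ j, b j = R' j / ∑ k, R' k)
    (xstar : Fin m → ℝ)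
    (hxstar : ∀ j, xstar j =
      (n : ℝ) * Real.sqrt (R j * R' j) / (∑ k, Real.sqrt (R k * R' k)) -
        ((n : ℝ) - 1) * b j) :
    (∑ j, xstar j = 1) ∧
    ((∀ j, 0 ≤ xstar j) →
      ∀ x : Fin m → ℝ, (∀ j, 0 ≤ x j) → (∑ j, x j = 1) →
        ∑ j, x j * R j / (((n : ℝ) - 1) * b j + x j) ≤
          ∑ j, xstar j * R j / (((n : ℝ) - 1) * b j + xstar j)) := by
  have : Nonempty (Fin m) := ⟨⟨0, hm⟩⟩
  have hn' : (2 : ℝ) ≤ n := by exact_mod_cast hn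
  have hT : 0 < ∑ k, R' k := Finset.sum_pos (fun k _ => hR' k) Finset.univ_nonempty
  have hs : ∀ j, 0 < Real.sqrt (R j * R' j) := fun j => Real.sqrt_pos.2 (mul_pos (hR j) (hR' j))
  have hS : 0 < ∑ k, Real.sqrt (R k * R' k) :=
    Finset.sum_pos (fun k _ => hs k) Finset.univ_nonempty
  have hbsum : ∑ j, b j = 1 := by
    simp only [hb, ← Finset.sum_div]
    exact div_self hT.ne'
  have hsum : ∑ j, xstar j = 1 := by
    simp only [hxstar, Finset.sum_sub_distrib, ← Finset.mul_sum, ← Finset.sum_div, hbsum]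
    rw [mul_div_cancel_right₀ _ hS.ne']
    ring
  refine ⟨hsum, fun _ x hx hxsum => ?_⟩
  set S := ∑ k, Real.sqrt (R k * R' k)
  set T := ∑ k, R' k
  have hc : ∀ j, 0 < ((n : ℝ) - 1) * b j := fun j => by
    rw [hb]
    exact mul_pos (by linarith) (div_pos (hR' j) hT)
  have hy : ∀ j, ((n : ℝ) - 1) * b j + xstar j = n * Real.sqrt (R j * R' j) / S := fun j => by
    rw [hxstar]
    ring
  have hypos : ∀ j, 0 < ((n : ℝ) - 1) * b j + xstar j := fun j => by
    rw [hy]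
    exact div_pos (mul_pos (by linarith) (hs j)) hS
  have hgrad : ∀ j, R j * (((n : ℝ) - 1) * b j) / (((n : ℝ) - 1) * b j + xstar j) ^ 2 =
      ((n : ℝ) - 1) * S ^ 2 / (T * n ^ 2) := fun j => by
    have hRj := (hR j).ne'
    have hRj' := (hR' j).ne'
    have hn0 : (n : ℝ) ≠ 0 := by linarith
    rw [hy, hb, div_pow, mul_pow, Real.sq_sqrt (mul_pos (hR j) (hR' j)).le]
    field_simp
  calc ∑ j, x j * R j / (((n : ℝ) - 1) * b j + x j)
      ≤ ∑ j, (xstar j * R j / (((n : ℝ) - 1) * b j + xstar j) +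
          ((n : ℝ) - 1) * S ^ 2 / (T * n ^ 2) * (x j - xstar j)) := by
        refine Finset.sum_le_sum fun j _ => ?_
        rw [← hgrad j]
        exact mul_div_add_le_tangent (hR j).le (hc j).le
          (add_pos_of_pos_of_nonneg (hc j) (hx j)) (hypos j)
    _ = ∑ j, xstar j * R j / (((n : ℝ) - 1) * b j + xstar j) := by
        rw [Finset.sum_add_distrib, ← Finset.mul_sum, Finset.sum_sub_distrib, hxsum, hsum]
        ring
end
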